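/- Let κ, q, c, η, T, σ be real numbers with κ > 0, q > 0, c > 0, η ≥ q², T > 0, and let Q be the explicit Riccati function Q(t) = −(1/2)[κ + q − √Δ ( √Δ sinh(√Δ(T−t)) + (κ+q+c) cosh(√Δ(T−t)) ) / ( √Δ cosh(√Δ(T−t)) + (κ+q+c) sinh(√Δ(T−t)) )] with Δ = (κ+q)² + η − q². Let θ₀ ≥ 0 and let θ : [0,T] → ℝ be differentiable with θ(0) = θ₀ and θ′(t) = −2(κ + q + 2Q(t))θ(t) + σ² for all t ∈ [0,T]. Then ∫₀ᵀ ((1/2)(q+2Q(t))² − q(q+2Q(t)) + η/2)·θ(t) dt + (c/2)θ(T) = Q(0)·θ₀ + σ²∫₀ᵀ Q(s) ds. -/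

import Mathlib

/-- The explicit Riccati function of the systemic risk LQ McKean-Vlasov control problem. -/
noncomputable def Qsys (κ q c η T : ℝ) (t : ℝ) : ℝ :=
  -(1/2) * (κ + q - Real.sqrt ((κ + q)^2 + η - q^2) *
    (Real.sqrt ((κ + q)^2 + η - q^2) * Real.sinh (Real.sqrt ((κ + q)^2 + η - q^2) * (T - t))
      + (κ + q + c) * Real.cosh (Real.sqrt ((κ + q)^2 + η - q^2) * (T - t))) /
    (Real.sqrt ((κ + q)^2 + η - q^2) * Real.cosh (Real.sqrt ((κ + q)^2 + η - q^2) * (T - t))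
      + (κ + q + c) * Real.sinh (Real.sqrt ((κ + q)^2 + η - q^2) * (T - t))))

lemma Qsys_discrim_pos {κ q η : ℝ} (hκ : 0 < κ) (hq : 0 < q) (hη : q ^ 2 ≤ η) :
    0 < (κ + q) ^ 2 + η - q ^ 2 := by
  have : 0 < (κ + q) ^ 2 := by positivity
  linarith

lemma Qsys_terminal {κ q c η T : ℝ} (hΔ : 0 < (κ + q) ^ 2 + η - q ^ 2) :
    Qsys κ q c η T T = c / 2 := by
  have hs := Real.sqrt_pos.2 hΔ
  simp only [Qsys, sub_self, mul_zero, Real.sinh_zero, Real.cosh_zero, mul_one, zero_add, add_zero]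
  field_simp
  ring

/-- The function `Qsys` solves the Riccati equation on `(-∞, T]`. -/
lemma hasDerivAt_Qsys {κ q c η T t : ℝ} (hm : 0 ≤ κ + q + c)
    (hΔ : 0 < (κ + q) ^ 2 + η - q ^ 2) (ht : t ≤ T) :
    HasDerivAt (Qsys κ q c η T)
      (2 * (κ + q) * Qsys κ q c η T t + 2 * Qsys κ q c η T t ^ 2 - (η - q ^ 2) / 2) t := by
  unfold Qsys
  have hs := Real.sqrt_pos.2 hΔ
  have hs2 := Real.sq_sqrt hΔ.le
  set s := Real.sqrt ((κ + q) ^ 2 + η - q ^ 2)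
  set m := κ + q + c
  have hr : HasDerivAt (fun t ↦ s * (T - t)) (-s) t := by
    simpa using ((hasDerivAt_id t).const_sub T).const_mul s
  have hnum := (hr.sinh.const_mul s).add (hr.cosh.const_mul m)
  have hden := (hr.cosh.const_mul s).add (hr.sinh.const_mul m)
  have hpos : 0 < s * Real.cosh (s * (T - t)) + m * Real.sinh (s * (T - t)) := by
    have hsinh : 0 ≤ Real.sinh (s * (T - t)) :=
      Real.sinh_nonneg_iff.2 (mul_nonneg hs.le (sub_nonneg.2 ht))
    have := Real.cosh_pos (s * (T - t))
    positivity
  have hη : η - q ^ 2 = s ^ 2 - (κ + q) ^ 2 := by linarith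
  convert! (((hnum.const_mul s).div hden hpos.ne').const_sub (κ + q)).const_mul (-(1 / 2)) using 1
  rw [hη]
  simp only [Pi.add_apply]
  generalize Real.sinh (s * (T - t)) = S at hpos ⊢
  generalize Real.cosh (s * (T - t)) = C at hpos ⊢
  generalize hB : s * C + m * S = B at hpos ⊢
  have hne := hpos.ne'
  field_simp
  rw [← hB]
  ring

theorem stmt7 (κ q c η T σ : ℝ) (hκ : 0 < κ) (hq : 0 < q) (hc : 0 < c)
    (hη : q^2 ≤ η) (hT : 0 < T)
    (θ₀ : ℝ) (hθ₀ : 0 ≤ θ₀) (θ : ℝ → ℝ) (hθinit : θ 0 = θ₀)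
    (hθ' : ∀ t ∈ Set.Icc (0:ℝ) T,
      HasDerivAt θ (-2 * (κ + q + 2 * Qsys κ q c η T t) * θ t + σ^2) t) :
    (∫ t in (0:ℝ)..T,
        ((1/2) * (q + 2 * Qsys κ q c η T t)^2 - q * (q + 2 * Qsys κ q c η T t) + η/2) * θ t)
      + (c/2) * θ T
    = Qsys κ q c η T 0 * θ₀ + σ^2 * (∫ s in (0:ℝ)..T, Qsys κ q c η T s) := by
  have hΔ := Qsys_discrim_pos hκ hq hη
  have hQ' (t : ℝ) (ht : t ∈ Set.Icc 0 T) :=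
    hasDerivAt_Qsys (by positivity : 0 ≤ κ + q + c) hΔ ht.2
  have hQc : ContinuousOn (Qsys κ q c η T) (Set.uIcc 0 T) := by
    rw [Set.uIcc_of_le hT.le]
    exact fun t ht ↦ (hQ' t ht).continuousAt.continuousWithinAt
  have hθc : ContinuousOn θ (Set.uIcc 0 T) := by
    rw [Set.uIcc_of_le hT.le]
    exact fun t ht ↦ (hθ' t ht).continuousAt.continuousWithinAt
  have hQi := (hQc.intervalIntegrable (μ := MeasureTheory.volume)).const_mul (σ ^ 2)
  have hcost : IntervalIntegrable (fun t ↦ ((1/2) * (q + 2 * Qsys κ q c η T t)^2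
      - q * (q + 2 * Qsys κ q c η T t) + η/2) * θ t) MeasureTheory.volume 0 T :=
    ContinuousOn.intervalIntegrable (by fun_prop)
  have hftc := intervalIntegral.integral_eq_sub_of_hasDerivAt
    (f := fun t ↦ Qsys κ q c η T t * θ t)
    (f' := fun t ↦ σ ^ 2 * Qsys κ q c η T t - ((1/2) * (q + 2 * Qsys κ q c η T t)^2
      - q * (q + 2 * Qsys κ q c η T t) + η/2) * θ t)
    (fun t ht ↦ by
      rw [Set.uIcc_of_le hT.le] at ht
      convert! (hQ' t ht).mul (hθ' t ht) using 1
      ring)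
    (hQi.sub hcost)
  rw [intervalIntegral.integral_sub hQi hcost, intervalIntegral.integral_const_mul,
    Qsys_terminal hΔ, hθinit] at hftc
  linarith
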